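/- Let B : (Fin 3 → ℝ) → (Fin 3 → ℝ) and p : (Fin 3 → ℝ) → ℝ be smooth, with div B = 0. Let J := curl B and assume the magneto-hydrostatic equation (J x) ×₃ (B x) = grad p x holds for all x. Then lie J B = 0 (J is a symmetry of B), and moreover ⟪B x, grad p x⟫ = 0 and ⟪J x, grad p x⟫ = 0 for all x (p is a first integral of both B and J). -/

import Mathlib

open Matrix
open scoped ContDiff

/-- Divergence of a vector field on `ℝ³`. -/
noncomputable def vdiv (X : (Fin 3 → ℝ) → (Fin 3 → ℝ)) (x : Fin 3 → ℝ) : ℝ :=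
  ∑ i : Fin 3, fderiv ℝ X x (Pi.single i 1) i

/-- Curl of a vector field on `ℝ³`. -/
noncomputable def vcurl (X : (Fin 3 → ℝ) → (Fin 3 → ℝ)) (x : Fin 3 → ℝ) : Fin 3 → ℝ :=
  ![fderiv ℝ X x (Pi.single 1 1) 2 - fderiv ℝ X x (Pi.single 2 1) 1,
    fderiv ℝ X x (Pi.single 2 1) 0 - fderiv ℝ X x (Pi.single 0 1) 2,
    fderiv ℝ X x (Pi.single 0 1) 1 - fderiv ℝ X x (Pi.single 1 1) 0]

/-- Lie bracket of vector fields on `ℝ³`. -/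
noncomputable def vlie (X Y : (Fin 3 → ℝ) → (Fin 3 → ℝ)) (x : Fin 3 → ℝ) : Fin 3 → ℝ :=
  fderiv ℝ Y x (X x) - fderiv ℝ X x (Y x)

/-- Gradient of a function on `ℝ³`. -/
noncomputable def vgrad (p : (Fin 3 → ℝ) → ℝ) (x : Fin 3 → ℝ) : Fin 3 → ℝ :=
  fun i => fderiv ℝ p x (Pi.single i 1)

theorem fderiv_crossProduct {X Y : (Fin 3 → ℝ) → (Fin 3 → ℝ)} {x : Fin 3 → ℝ}
    (hX : DifferentiableAt ℝ X x) (hY : DifferentiableAt ℝ Y x) (v : Fin 3 → ℝ) :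
    fderiv ℝ (fun y => X y ⨯₃ Y y) x v = fderiv ℝ X x v ⨯₃ Y x + X x ⨯₃ fderiv ℝ Y x v := by
  have h := (crossProduct (R := ℝ)).toContinuousBilinearMap.fderiv_of_bilinear hX hY
  have h' := DFunLike.congr_fun h v
  simpa [add_comm] using h'

/-- A linear map on `ℝ³` expanded in the standard basis. -/
theorem fin_three_map_apply (L : (Fin 3 → ℝ) →L[ℝ] (Fin 3 → ℝ)) (v : Fin 3 → ℝ) (i : Fin 3) :
    L v i = v 0 * L (Pi.single 0 1) i + v 1 * L (Pi.single 1 1) i + v 2 * L (Pi.single 2 1) i := by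
  conv_lhs => rw [pi_eq_sum_univ' v]
  simp [Fin.sum_univ_three]

/-- `curl (X × Y) = (div Y) X - (div X) Y - [X, Y]`. -/
theorem vcurl_crossProduct {X Y : (Fin 3 → ℝ) → (Fin 3 → ℝ)} {x : Fin 3 → ℝ}
    (hX : DifferentiableAt ℝ X x) (hY : DifferentiableAt ℝ Y x) :
    vcurl (fun y => X y ⨯₃ Y y) x = vdiv Y x • X x - vdiv X x • Y x - vlie X Y x := by
  ext i
  simp only [vcurl, vdiv, vlie, fderiv_crossProduct hX hY, Fin.sum_univ_three, Pi.sub_apply,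
    Pi.smul_apply, smul_eq_mul, fin_three_map_apply _ (X x), fin_three_map_apply _ (Y x)]
  fin_cases i <;> simp [cross_apply] <;> ring

/-- Second partial derivatives in terms of the iterated Fréchet derivative. -/
theorem fderiv_fderiv_apply_const {E F : Type*} [NormedAddCommGroup E] [NormedSpace ℝ E]
    [NormedAddCommGroup F] [NormedSpace ℝ F] {f : E → F} {x : E}
    (hf : ContDiffAt ℝ 2 f x) (v w : E) :
    fderiv ℝ (fun y => fderiv ℝ f y w) x v = fderiv ℝ (fderiv ℝ f) x v w := by
  have h : DifferentiableAt ℝ (fderiv ℝ f) x :=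
    (hf.fderiv_right (m := 1) (by norm_num)).differentiableAt (by norm_num)
  simp [fderiv_clm_apply h (differentiableAt_const w)]

theorem fderiv_fderiv_comm {E F : Type*} [NormedAddCommGroup E] [NormedSpace ℝ E]
    [NormedAddCommGroup F] [NormedSpace ℝ F] {f : E → F} {x : E}
    (hf : ContDiffAt ℝ 2 f x) (v w : E) :
    fderiv ℝ (fderiv ℝ f) x v w = fderiv ℝ (fderiv ℝ f) x w v :=
  (hf.isSymmSndFDerivAt (by simp)).eq v w

theorem vcurl_vgrad {p : (Fin 3 → ℝ) → ℝ} {x : Fin 3 → ℝ} (hp : ContDiffAt ℝ 2 p x) :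
    vcurl (vgrad p) x = 0 := by
  have hd : DifferentiableAt ℝ (fderiv ℝ p) x :=
    (hp.fderiv_right (m := 1) (by norm_num)).differentiableAt (by norm_num)
  have h (v : Fin 3 → ℝ) (i : Fin 3) :
      fderiv ℝ (vgrad p) x v i = fderiv ℝ (fderiv ℝ p) x v (Pi.single i 1) := by
    rw [← fderiv_fderiv_apply_const hp]
    unfold vgrad
    rw [fderiv_pi fun i => hd.clm_apply (differentiableAt_const _)]
    rfl
  ext i
  simp only [vcurl, h]
  fin_cases i <;> simp [fderiv_fderiv_comm hp]

theorem differentiableAt_vcurl {X : (Fin 3 → ℝ) → (Fin 3 → ℝ)} {x : Fin 3 → ℝ}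
    (hX : ContDiffAt ℝ 2 X x) : DifferentiableAt ℝ (vcurl X) x := by
  have hd : DifferentiableAt ℝ (fderiv ℝ X) x :=
    (hX.fderiv_right (m := 1) (by norm_num)).differentiableAt (by norm_num)
  rw [differentiableAt_pi]
  intro i
  fin_cases i <;> simp [vcurl] <;> fun_prop

theorem vdiv_vcurl {X : (Fin 3 → ℝ) → (Fin 3 → ℝ)} {x : Fin 3 → ℝ} (hX : ContDiffAt ℝ 2 X x) :
    vdiv (vcurl X) x = 0 := by
  have hd : DifferentiableAt ℝ (fderiv ℝ X) x :=
    (hX.fderiv_right (m := 1) (by norm_num)).differentiableAt (by norm_num)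
  have hw (w : Fin 3 → ℝ) : DifferentiableAt ℝ (fun y => fderiv ℝ X y w) x := by fun_prop
  have hc (w v : Fin 3 → ℝ) (j : Fin 3) :
      fderiv ℝ (fun y => fderiv ℝ X y w j) x v = fderiv ℝ (fderiv ℝ X) x v w j := by
    rw [← fderiv_fderiv_apply_const hX, fderiv_apply (hw w)]
    rfl
  have hs (w w' v : Fin 3 → ℝ) (j j' : Fin 3) :
      fderiv ℝ (fun y => fderiv ℝ X y w j - fderiv ℝ X y w' j') x v =
        fderiv ℝ (fderiv ℝ X) x v w j - fderiv ℝ (fderiv ℝ X) x v w' j' := by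
    rw [fderiv_fun_sub (by fun_prop) (by fun_prop), _root_.sub_apply, hc, hc]
  have hi (v : Fin 3 → ℝ) (i : Fin 3) :
      fderiv ℝ (vcurl X) x v i = fderiv ℝ (fun y => vcurl X y i) x v := by
    rw [fderiv_apply (differentiableAt_vcurl hX)]
    rfl
  simp only [vdiv, Fin.sum_univ_three, hi]
  simp only [vcurl, Matrix.cons_val, hs]
  rw [fderiv_fderiv_comm hX (Pi.single 1 1) (Pi.single 0 1),
    fderiv_fderiv_comm hX (Pi.single 2 1) (Pi.single 0 1),
    fderiv_fderiv_comm hX (Pi.single 2 1) (Pi.single 1 1)]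
  ring

/-- MHS fields: if `div B = 0` and `J × B = ∇p` with `J = curl B`, then
`[J, B] = 0` and `p` is a first integral of both `B` and `J`. -/
theorem stmt_8 (B : (Fin 3 → ℝ) → (Fin 3 → ℝ)) (p : (Fin 3 → ℝ) → ℝ)
    (hB : ContDiff ℝ ∞ B) (hp : ContDiff ℝ ∞ p)
    (hdivB : ∀ x, vdiv B x = 0)
    (hMHS : ∀ x, (vcurl B x) ⨯₃ (B x) = vgrad p x) :
    (∀ x, vlie (vcurl B) B x = 0) ∧
      (∀ x, B x ⬝ᵥ vgrad p x = 0) ∧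
      (∀ x, vcurl B x ⬝ᵥ vgrad p x = 0) := by
  refine ⟨fun x => ?_, fun x => ?_, fun x => ?_⟩
  · have hB2 : ContDiffAt ℝ 2 B x := (contDiff_infty.mp hB 2).contDiffAt
    have hp2 : ContDiffAt ℝ 2 p x := (contDiff_infty.mp hp 2).contDiffAt
    have h := vcurl_crossProduct (differentiableAt_vcurl hB2)
      (hB2.differentiableAt (by norm_num))
    rw [funext hMHS, vcurl_vgrad hp2, hdivB, vdiv_vcurl hB2] at h
    simpa using h
  · rw [← hMHS, dot_cross_self]
  · rw [← hMHS, dot_self_cross]
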